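/- arXiv:2206.10008 — 3 statements merged into one kernel-verified Lean document; each statement's English description precedes it below -/
import Mathlib

section
/- Let d be an odd squarefree positive integer and let D be a positive divisor of d. Then the elliptic curve E : y² = x³ − dD²x over ℚ satisfies: the rank of the abelian group E(ℚ) of rational points is at most 2ω(d). -/
open WeierstrassCurve WeierstrassCurve.Affine Height

/-- The Weierstrass curve `y² = x³ + bx` over `ℚ`. -/
abbrev twoTorsionCurve (b : ℚ) : WeierstrassCurve ℚ :=
  { a₁ := 0, a₂ := 0, a₃ := 0, a₄ := b, a₆ := 0 }

namespace twoTorsionCurve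

variable {b : ℚ}

lemma nonsingular_iff_equation (hb : b ≠ 0) {x y : ℚ} :
    (twoTorsionCurve b).toAffine.Nonsingular x y ↔ y ^ 2 = x ^ 3 + b * x := by
  rw [← equation_iff_nonsingular_of_Δ_ne_zero, equation_iff]
  · simp
  · simp [WeierstrassCurve.Δ, WeierstrassCurve.b₂, WeierstrassCurve.b₄, WeierstrassCurve.b₆,
      WeierstrassCurve.b₈, hb]

lemma equation_of_nonsingular {x y : ℚ} (h : (twoTorsionCurve b).toAffine.Nonsingular x y) :
    y ^ 2 = x ^ 3 + b * x := by
  simpa [equation_iff] using h.1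

lemma deriv_ne_zero {x y : ℚ} (h : (twoTorsionCurve b).toAffine.Nonsingular x y) (hy : y = 0) :
    3 * x ^ 2 + b ≠ 0 := by
  have := ((WeierstrassCurve.Affine.nonsingular_iff _ _).1 h).2
  subst hy
  simpa [eq_comm] using this

lemma neg_some {x y : ℚ} (h : (twoTorsionCurve b).toAffine.Nonsingular x y)
    (h' : (twoTorsionCurve b).toAffine.Nonsingular x (-y)) :
    -Point.some x y h = Point.some x (-y) h' := by
  rw [Point.neg_some]
  simp [negY]

/-- The line `y = ℓx + m` meets the curve `y² = x³ + bx` at points with `x`-coordinates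
`x₁`, `x₂`, `x₃`, counted with multiplicity. -/
structure IsLine (b ℓ m x₁ x₂ x₃ : ℚ) : Prop where
  sum : x₁ + x₂ + x₃ = ℓ ^ 2
  sum_mul : x₁ * x₂ + x₁ * x₃ + x₂ * x₃ = b - 2 * ℓ * m
  prod : x₁ * x₂ * x₃ = m ^ 2

namespace IsLine

variable {ℓ m x₁ x₂ x₃ : ℚ}

lemma swap (h : IsLine b ℓ m x₁ x₂ x₃) : IsLine b ℓ m x₂ x₁ x₃ :=
  ⟨by linear_combination h.sum, by linear_combination h.sum_mul, by linear_combination h.prod⟩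

lemma rotate (h : IsLine b ℓ m x₁ x₂ x₃) : IsLine b ℓ m x₂ x₃ x₁ :=
  ⟨by linear_combination h.sum, by linear_combination h.sum_mul, by linear_combination h.prod⟩

lemma add_eq_zero (h : IsLine b ℓ m x₁ x₂ x₃) {y₁ y₂ y₃ : ℚ}
    (h₁ : (twoTorsionCurve b).toAffine.Nonsingular x₁ y₁)
    (h₂ : (twoTorsionCurve b).toAffine.Nonsingular x₂ y₂)
    (h₃ : (twoTorsionCurve b).toAffine.Nonsingular x₃ y₃)
    (e₁ : y₁ = ℓ * x₁ + m) (e₂ : y₂ = ℓ * x₂ + m) (e₃ : y₃ = ℓ * x₃ + m) :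
    Point.some x₁ y₁ h₁ + Point.some x₂ y₂ h₂ + Point.some x₃ y₃ h₃ = 0 := by
  obtain ⟨s₁, s₂, s₃⟩ := h
  have tangent (hx : x₁ = x₂) : 3 * x₁ ^ 2 + b = 2 * ℓ * y₁ := by
    subst hx
    linear_combination 2 * x₁ * s₁ - s₂ - 2 * ℓ * e₁
  have hne : ¬(x₁ = x₂ ∧ y₁ = (twoTorsionCurve b).toAffine.negY x₂ y₂) := by
    rintro ⟨hx, hy⟩
    have hy' : y₁ = -y₂ := by simpa [negY] using hy
    have h0 : y₁ = 0 := by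
      subst hx
      linarith
    exact deriv_ne_zero h₁ h0 (by rw [tangent hx, h0, mul_zero])
  have hslope : (twoTorsionCurve b).toAffine.slope x₁ x₂ y₁ y₂ = ℓ := by
    by_cases hx : x₁ = x₂
    · rw [slope_of_Y_ne hx fun hy ↦ hne ⟨hx, hy⟩]
      have hy : y₁ ≠ 0 := by
        intro hy
        exact hne ⟨hx, by subst hx; simp [negY]; linarith⟩
      simp only [negY]
      rw [div_eq_iff (by simpa [← two_mul] using hy)]
      linear_combination tangent hx
    · rw [slope_of_X_ne hx, div_eq_iff (sub_ne_zero.2 hx)]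
      linear_combination e₁ - e₂
  rw [Point.add_some hne]
  apply Point.add_of_Y_eq
  · rw [hslope, addX]
    linear_combination -s₁
  · rw [hslope]
    simp only [addY, negAddY, negY, addX]
    linear_combination -e₁ + e₃ + ℓ * s₁

end IsLine

lemma exists_isLine (hb : b ≠ 0) {x₁ x₂ y₁ y₂ : ℚ}
    (h₁ : (twoTorsionCurve b).toAffine.Nonsingular x₁ y₁)
    (h₂ : (twoTorsionCurve b).toAffine.Nonsingular x₂ y₂) (hne : ¬(x₁ = x₂ ∧ y₁ = -y₂)) :
    ∃ ℓ m x₃ y₃ : ℚ, ∃ h₃ : (twoTorsionCurve b).toAffine.Nonsingular x₃ y₃,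
      IsLine b ℓ m x₁ x₂ x₃ ∧ y₁ = ℓ * x₁ + m ∧ y₂ = ℓ * x₂ + m ∧ y₃ = ℓ * x₃ + m ∧
      Point.some x₁ y₁ h₁ + Point.some x₂ y₂ h₂ = -Point.some x₃ y₃ h₃ := by
  have E₁ := equation_of_nonsingular h₁
  have E₂ := equation_of_nonsingular h₂
  obtain ⟨ℓ, m, x₃, hl, e₁, e₂⟩ : ∃ ℓ m x₃, IsLine b ℓ m x₁ x₂ x₃ ∧ y₁ = ℓ * x₁ + m ∧
      y₂ = ℓ * x₂ + m := by
    by_cases hx : x₁ = x₂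
    · subst hx
      have hy : y₁ = y₂ := by
        have : (y₁ - y₂) * (y₁ + y₂) = 0 := by linear_combination E₁ - E₂
        rcases mul_eq_zero.1 this with h | h
        · linarith
        · exact absurd ⟨rfl, by linarith⟩ hne
      subst hy
      have hy : y₁ ≠ 0 := fun h ↦ hne ⟨rfl, by simp [h]⟩
      obtain ⟨ℓ, hℓ⟩ : ∃ ℓ, 2 * y₁ * ℓ = 3 * x₁ ^ 2 + b :=
        ⟨(3 * x₁ ^ 2 + b) / (2 * y₁), by field_simp⟩
      refine ⟨ℓ, y₁ - ℓ * x₁, ℓ ^ 2 - x₁ - x₁, ⟨by ring, ?_, ?_⟩, by ring, by ring⟩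
      · linear_combination hℓ
      · linear_combination -E₁ + x₁ * hℓ
    · obtain ⟨ℓ, hℓ⟩ : ∃ ℓ, ℓ * (x₁ - x₂) = y₁ - y₂ :=
        ⟨(y₁ - y₂) / (x₁ - x₂), div_mul_cancel₀ _ (sub_ne_zero.2 hx)⟩
      obtain rfl : y₂ = y₁ - ℓ * (x₁ - x₂) := by linear_combination hℓ
      have hmul : x₁ * x₂ + x₁ * (ℓ ^ 2 - x₁ - x₂) + x₂ * (ℓ ^ 2 - x₁ - x₂) =
          b - 2 * ℓ * (y₁ - ℓ * x₁) := by
        refine mul_left_cancel₀ (sub_ne_zero.2 hx) ?_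
        linear_combination E₁ - E₂
      exact ⟨ℓ, y₁ - ℓ * x₁, ℓ ^ 2 - x₁ - x₂,
        ⟨by ring, hmul, by linear_combination x₁ * hmul - E₁⟩, by ring, by ring⟩
  have h₃ : (twoTorsionCurve b).toAffine.Nonsingular x₃ (ℓ * x₃ + m) :=
    (nonsingular_iff_equation hb).2
      (by linear_combination -x₃ ^ 2 * hl.sum + x₃ * hl.sum_mul - hl.prod)
  exact ⟨ℓ, m, x₃, ℓ * x₃ + m, h₃, hl, e₁, e₂, rfl,
    eq_neg_of_add_eq_zero_left (hl.add_eq_zero h₁ h₂ h₃ e₁ e₂ rfl)⟩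

/-- A map on points that vanishes at infinity, commutes with negation and sends three collinear
points to elements with sum zero is additive. -/
def homOfCollinear (hb : b ≠ 0) {G : Type*} [AddCommGroup G]
    (f : (twoTorsionCurve b).toAffine.Point → G) (h0 : f 0 = 0) (hneg : ∀ P, f (-P) = -f P)
    (hline : ∀ ℓ m x₁ x₂ x₃ : ℚ, IsLine b ℓ m x₁ x₂ x₃ →
      ∀ (h₁ : (twoTorsionCurve b).toAffine.Nonsingular x₁ (ℓ * x₁ + m))
        (h₂ : (twoTorsionCurve b).toAffine.Nonsingular x₂ (ℓ * x₂ + m))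
        (h₃ : (twoTorsionCurve b).toAffine.Nonsingular x₃ (ℓ * x₃ + m)),
      f (.some _ _ h₁) + f (.some _ _ h₂) + f (.some _ _ h₃) = 0) :
    (twoTorsionCurve b).toAffine.Point →+ G where
  toFun := f
  map_zero' := h0
  map_add' P Q := by
    rcases P with _ | ⟨x₁, y₁, h₁⟩
    · rw [← Point.zero_def, h0, zero_add, zero_add]
    rcases Q with _ | ⟨x₂, y₂, h₂⟩
    · rw [← Point.zero_def, h0, add_zero, add_zero]
    by_cases hne : x₁ = x₂ ∧ y₁ = -y₂
    · obtain ⟨rfl, rfl⟩ := hne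
      rw [Point.add_of_Y_eq rfl (by simp [negY]), h0, ← neg_some h₂ h₁, hneg, neg_add_cancel]
    · obtain ⟨ℓ, m, x₃, y₃, h₃, hl, rfl, rfl, rfl, h⟩ := exists_isLine hb h₁ h₂ hne
      rw [h, hneg, ← add_eq_zero_iff_neg_eq, add_comm]
      exact hline ℓ m x₁ x₂ x₃ hl h₁ h₂ h₃

/-- The homomorphism `(x, y) ↦ χ x` of the descent by a `2`-isogeny, for a quadratic
character `χ` on `ℚ`. -/
noncomputable def xHom (hb : b ≠ 0) {G : Type*} [AddCommGroup G] (χ : ℚ → G)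
    (hχ : ∀ x y, x ≠ 0 → y ≠ 0 → χ (x * y) = χ x + χ y) (hG : ∀ g : G, g + g = 0) :
    (twoTorsionCurve b).toAffine.Point →+ G :=
  homOfCollinear hb
    (fun P ↦ match P with
      | .zero => 0
      | .some x _ _ => if x = 0 then χ b else χ x) rfl
    (by
      rintro (_ | ⟨x, y, h⟩)
      · exact neg_zero.symm
      · exact (eq_neg_of_add_eq_zero_left (hG _)))
    (by
      intro ℓ m x₁ x₂ x₃ hl h₁ h₂ h₃
      have key : ∀ {x₂ x₃ : ℚ}, IsLine b ℓ m 0 x₂ x₃ →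
          χ b + (if x₂ = 0 then χ b else χ x₂) + (if x₃ = 0 then χ b else χ x₃) = 0 := by
        intro x₂ x₃ hl
        have hm : m = 0 := by simpa using hl.prod.symm
        have hbx : x₂ * x₃ = b := by simpa [hm] using hl.sum_mul
        have h₂ : x₂ ≠ 0 := by rintro rfl; simp at hbx; exact hb hbx.symm
        have h₃ : x₃ ≠ 0 := by rintro rfl; simp at hbx; exact hb hbx.symm
        rw [if_neg h₂, if_neg h₃, add_assoc, ← hχ _ _ h₂ h₃, hbx, hG]
      change (if x₁ = 0 then χ b else χ x₁) + (if x₂ = 0 then χ b else χ x₂) +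
        (if x₃ = 0 then χ b else χ x₃) = 0
      by_cases z₁ : x₁ = 0
      · subst z₁
        simpa using key hl
      by_cases z₂ : x₂ = 0
      · subst z₂
        rw [← key hl.swap, if_pos rfl]
        abel
      by_cases z₃ : x₃ = 0
      · subst z₃
        rw [← key hl.rotate.rotate, if_pos rfl]
        abel
      have hm : m ≠ 0 := by
        rintro rfl
        have := hl.prod
        simp_all
      rw [if_neg z₁, if_neg z₂, if_neg z₃, ← hχ _ _ z₁ z₂, ← hχ _ _ (mul_ne_zero z₁ z₂) z₃, hl.prod,
        sq, hχ _ _ hm hm, hG])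

section xHom

variable (hb : b ≠ 0) {G : Type*} [AddCommGroup G] (χ : ℚ → G)
    (hχ : ∀ x y, x ≠ 0 → y ≠ 0 → χ (x * y) = χ x + χ y) (hG : ∀ g : G, g + g = 0)

lemma xHom_some {x y : ℚ} (h : (twoTorsionCurve b).toAffine.Nonsingular x y) (hx : x ≠ 0) :
    xHom hb χ hχ hG (.some x y h) = χ x :=
  if_neg hx

lemma xHom_some_zero {y : ℚ} (h : (twoTorsionCurve b).toAffine.Nonsingular 0 y) :
    xHom hb χ hχ hG (.some 0 y h) = χ b :=
  (if_pos rfl : (if (0 : ℚ) = 0 then χ b else χ 0) = χ b)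

end xHom

lemma nonsingular_isogeny (hb : b ≠ 0) {x y : ℚ}
    (h : (twoTorsionCurve (-4 * b)).toAffine.Nonsingular x y) (hx : x ≠ 0) :
    (twoTorsionCurve b).toAffine.Nonsingular (y ^ 2 / (4 * x ^ 2))
      (y * (-4 * b - x ^ 2) / (8 * x ^ 2)) := by
  have E := equation_of_nonsingular h
  rw [nonsingular_iff_equation hb]
  field_simp
  have E4 : y ^ 4 = (x ^ 3 + -4 * b * x) ^ 2 := by rw [← E]; ring
  rw [E4]
  ring

/-- The `2`-isogeny from `y² = x³ - 4bx` to `y² = x³ + bx`, on points. -/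
noncomputable def isogenyFun (hb : b ≠ 0) :
    (twoTorsionCurve (-4 * b)).toAffine.Point → (twoTorsionCurve b).toAffine.Point
  | .zero => 0
  | .some x _ h => if hx : x = 0 then 0 else .some _ _ (nonsingular_isogeny hb h hx)

lemma isogenyFun_some (hb : b ≠ 0) {x y : ℚ}
    (h : (twoTorsionCurve (-4 * b)).toAffine.Nonsingular x y) (hx : x ≠ 0) :
    isogenyFun hb (.some x y h) = .some _ _ (nonsingular_isogeny hb h hx) :=
  dif_neg hx

lemma isogenyFun_some_zero (hb : b ≠ 0) {y : ℚ}
    (h : (twoTorsionCurve (-4 * b)).toAffine.Nonsingular 0 y) :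
    isogenyFun hb (.some 0 y h) = 0 := by
  simp [isogenyFun]

lemma isogenyFun_neg (hb : b ≠ 0) (P : (twoTorsionCurve (-4 * b)).toAffine.Point) :
    isogenyFun hb (-P) = -isogenyFun hb P := by
  rcases P with _ | ⟨x, y, h⟩
  · rfl
  have h' : (twoTorsionCurve (-4 * b)).toAffine.Nonsingular x (-y) := by
    simpa [negY] using (nonsingular_neg x y).2 h
  rw [neg_some h h']
  by_cases hx : x = 0
  · subst hx
    simp only [isogenyFun_some_zero, neg_zero]
  · rw [isogenyFun_some hb h' hx, isogenyFun_some hb h hx, Point.neg_some, Point.some.injEq]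
    simp only [negY]
    constructor <;> ring

lemma isogenyFun_add_eq_zero_of_zero (hb : b ≠ 0) {ℓ m x₂ x₃ : ℚ}
    (hl : IsLine (-4 * b) ℓ m 0 x₂ x₃)
    (h₂ : (twoTorsionCurve (-4 * b)).toAffine.Nonsingular x₂ (ℓ * x₂ + m))
    (h₃ : (twoTorsionCurve (-4 * b)).toAffine.Nonsingular x₃ (ℓ * x₃ + m)) :
    isogenyFun hb (.some _ _ h₂) + isogenyFun hb (.some _ _ h₃) = 0 := by
  obtain rfl : m = 0 := by simpa using hl.prod.symm
  have hbx : x₂ * x₃ = -4 * b := by simpa using hl.sum_mul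
  have z₂ : x₂ ≠ 0 := by rintro rfl; simp at hbx; exact hb hbx
  have z₃ : x₃ ≠ 0 := by rintro rfl; simp at hbx; exact hb hbx
  rw [isogenyFun_some hb h₂ z₂, isogenyFun_some hb h₃ z₃]
  apply Point.add_of_Y_eq
  · field_simp
    ring
  · simp only [negY, ← hbx]
    field_simp
    ring

lemma isogenyFun_add_add_eq_zero (hb : b ≠ 0) {ℓ m x₁ x₂ x₃ : ℚ}
    (hl : IsLine (-4 * b) ℓ m x₁ x₂ x₃)
    (h₁ : (twoTorsionCurve (-4 * b)).toAffine.Nonsingular x₁ (ℓ * x₁ + m))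
    (h₂ : (twoTorsionCurve (-4 * b)).toAffine.Nonsingular x₂ (ℓ * x₂ + m))
    (h₃ : (twoTorsionCurve (-4 * b)).toAffine.Nonsingular x₃ (ℓ * x₃ + m))
    (z₁ : x₁ ≠ 0) (z₂ : x₂ ≠ 0) (z₃ : x₃ ≠ 0) :
    isogenyFun hb (.some _ _ h₁) + isogenyFun hb (.some _ _ h₂) +
      isogenyFun hb (.some _ _ h₃) = 0 := by
  have hm : m ≠ 0 := by
    rintro rfl
    have := hl.prod
    simp_all
  rw [isogenyFun_some hb h₁ z₁, isogenyFun_some hb h₂ z₂, isogenyFun_some hb h₃ z₃]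
  have hY {x : ℚ} (h : (twoTorsionCurve (-4 * b)).toAffine.Nonsingular x (ℓ * x + m))
      (hx : x ≠ 0) : (ℓ * x + m) * (-4 * b - x ^ 2) / (8 * x ^ 2) =
      -(ℓ + 4 * b / m) / 2 * ((ℓ * x + m) ^ 2 / (4 * x ^ 2)) + -(m - 4 * b * ℓ ^ 2 / m) / 8 := by
    have E := equation_of_nonsingular h
    field_simp
    linear_combination 8 * ℓ * m * E
  refine IsLine.add_eq_zero (ℓ := -(ℓ + 4 * b / m) / 2) (m := -(m - 4 * b * ℓ ^ 2 / m) / 8) ?_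
    _ _ _ (hY h₁ z₁) (hY h₂ z₂) (hY h₃ z₃)
  have hu {x : ℚ} (hx : x ≠ 0) : (ℓ * x + m) ^ 2 / (4 * x ^ 2) = (ℓ + m * x⁻¹) ^ 2 / 4 := by
    field_simp
  rw [hu z₁, hu z₂, hu z₃]
  have i₁ : x₁⁻¹ + x₂⁻¹ + x₃⁻¹ = (-4 * b - 2 * ℓ * m) / m ^ 2 := by
    rw [← hl.prod, ← hl.sum_mul]
    field_simp
    ring
  have i₂ : x₁⁻¹ * x₂⁻¹ + x₁⁻¹ * x₃⁻¹ + x₂⁻¹ * x₃⁻¹ = ℓ ^ 2 / m ^ 2 := by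
    rw [← hl.prod, ← hl.sum]
    field_simp
    ring
  have i₃ : x₁⁻¹ * x₂⁻¹ * x₃⁻¹ = 1 / m ^ 2 := by
    rw [← hl.prod]
    field_simp
  have u₁ : (ℓ + m * x₁⁻¹) + (ℓ + m * x₂⁻¹) + (ℓ + m * x₃⁻¹) = ℓ - 4 * b / m := by
    have : (ℓ + m * x₁⁻¹) + (ℓ + m * x₂⁻¹) + (ℓ + m * x₃⁻¹) =
      3 * ℓ + m * (x₁⁻¹ + x₂⁻¹ + x₃⁻¹) := by ring
    rw [this, i₁]
    field_simp
    ring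
  have u₂ : (ℓ + m * x₁⁻¹) * (ℓ + m * x₂⁻¹) + (ℓ + m * x₁⁻¹) * (ℓ + m * x₃⁻¹) +
      (ℓ + m * x₂⁻¹) * (ℓ + m * x₃⁻¹) = -8 * b * ℓ / m := by
    have : (ℓ + m * x₁⁻¹) * (ℓ + m * x₂⁻¹) + (ℓ + m * x₁⁻¹) * (ℓ + m * x₃⁻¹) +
      (ℓ + m * x₂⁻¹) * (ℓ + m * x₃⁻¹) = 3 * ℓ ^ 2 + 2 * ℓ * m * (x₁⁻¹ + x₂⁻¹ + x₃⁻¹) +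
        m ^ 2 * (x₁⁻¹ * x₂⁻¹ + x₁⁻¹ * x₃⁻¹ + x₂⁻¹ * x₃⁻¹) := by ring
    rw [this, i₁, i₂]
    field_simp
    ring
  have u₃ : (ℓ + m * x₁⁻¹) * (ℓ + m * x₂⁻¹) * (ℓ + m * x₃⁻¹) = m - 4 * b * ℓ ^ 2 / m := by
    have : (ℓ + m * x₁⁻¹) * (ℓ + m * x₂⁻¹) * (ℓ + m * x₃⁻¹) =
      ℓ ^ 3 + ℓ ^ 2 * m * (x₁⁻¹ + x₂⁻¹ + x₃⁻¹) +
        ℓ * m ^ 2 * (x₁⁻¹ * x₂⁻¹ + x₁⁻¹ * x₃⁻¹ + x₂⁻¹ * x₃⁻¹) +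
        m ^ 3 * (x₁⁻¹ * x₂⁻¹ * x₃⁻¹) := by ring
    rw [this, i₁, i₂, i₃]
    field_simp
    ring
  generalize ℓ + m * x₁⁻¹ = v₁ at *
  generalize ℓ + m * x₂⁻¹ = v₂ at *
  generalize ℓ + m * x₃⁻¹ = v₃ at *
  refine ⟨?_, ?_, ?_⟩
  · have : v₁ ^ 2 / 4 + v₂ ^ 2 / 4 + v₃ ^ 2 / 4 =
      ((v₁ + v₂ + v₃) ^ 2 - 2 * (v₁ * v₂ + v₁ * v₃ + v₂ * v₃)) / 4 := by ring
    rw [this, u₁, u₂]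
    field_simp
    ring
  · have : v₁ ^ 2 / 4 * (v₂ ^ 2 / 4) + v₁ ^ 2 / 4 * (v₃ ^ 2 / 4) + v₂ ^ 2 / 4 * (v₃ ^ 2 / 4) =
      ((v₁ * v₂ + v₁ * v₃ + v₂ * v₃) ^ 2 - 2 * (v₁ * v₂ * v₃) * (v₁ + v₂ + v₃)) / 16 := by ring
    rw [this, u₁, u₂, u₃]
    field_simp
    ring
  · have : v₁ ^ 2 / 4 * (v₂ ^ 2 / 4) * (v₃ ^ 2 / 4) = (v₁ * v₂ * v₃) ^ 2 / 64 := by ring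
    rw [this, u₃]
    ring

/-- The `2`-isogeny from `y² = x³ - 4bx` to `y² = x³ + bx`, as a homomorphism. -/
noncomputable def isogeny (hb : b ≠ 0) :
    (twoTorsionCurve (-4 * b)).toAffine.Point →+ (twoTorsionCurve b).toAffine.Point :=
  homOfCollinear (mul_ne_zero (by norm_num) hb) (isogenyFun hb) rfl (isogenyFun_neg hb) <| by
    intro ℓ m x₁ x₂ x₃ hl h₁ h₂ h₃
    by_cases z₁ : x₁ = 0
    · subst z₁
      rw [isogenyFun_some_zero, zero_add, isogenyFun_add_eq_zero_of_zero hb hl]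
    by_cases z₂ : x₂ = 0
    · subst z₂
      rw [isogenyFun_some_zero hb h₂, add_zero, isogenyFun_add_eq_zero_of_zero hb hl.swap]
    by_cases z₃ : x₃ = 0
    · subst z₃
      rw [isogenyFun_some_zero hb h₃, add_zero, isogenyFun_add_eq_zero_of_zero hb hl.rotate.rotate]
    exact isogenyFun_add_add_eq_zero hb hl h₁ h₂ h₃ z₁ z₂ z₃

lemma isogeny_some (hb : b ≠ 0) {x y : ℚ}
    (h : (twoTorsionCurve (-4 * b)).toAffine.Nonsingular x y) (hx : x ≠ 0) :
    isogeny hb (.some x y h) = .some _ _ (nonsingular_isogeny hb h hx) :=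
  isogenyFun_some hb h hx

lemma isogeny_some_zero (hb : b ≠ 0) {y : ℚ}
    (h : (twoTorsionCurve (-4 * b)).toAffine.Nonsingular 0 y) :
    isogeny hb (.some 0 y h) = 0 :=
  isogenyFun_some_zero hb h

lemma some_mem_range_isogeny (hb : b ≠ 0) {x y : ℚ}
    (h : (twoTorsionCurve b).toAffine.Nonsingular x y) (hx : x ≠ 0) (hsq : IsSquare x) :
    Point.some x y h ∈ (isogeny hb).range := by
  obtain ⟨s, rfl⟩ := hsq
  have hs : s ≠ 0 := by rintro rfl; simp at hx
  have E := equation_of_nonsingular h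
  obtain ⟨w, rfl⟩ : ∃ w, y = s * w := ⟨y / s, by field_simp⟩
  have hw : w ^ 2 = s ^ 4 + b := by
    refine mul_left_cancel₀ (pow_ne_zero 2 hs) ?_
    linear_combination E
  have hprod : (2 * (s ^ 2 + w)) * (2 * (s ^ 2 - w)) = -4 * b := by linear_combination -4 * hw
  have hx' : 2 * (s ^ 2 + w) ≠ 0 := by
    intro h0
    rw [h0, zero_mul] at hprod
    exact hb (by linarith)
  have h' : (twoTorsionCurve (-4 * b)).toAffine.Nonsingular (2 * (s ^ 2 + w))
      (-2 * s * (2 * (s ^ 2 + w))) := by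
    rw [nonsingular_iff_equation (mul_ne_zero (by norm_num) hb), ← hprod]
    ring
  have hx'' : s ^ 2 + w ≠ 0 := right_ne_zero_of_mul hx'
  refine ⟨.some _ _ h', ?_⟩
  rw [isogeny_some hb h' hx', Point.some.injEq, ← hprod]
  constructor
  · field_simp
    ring
  · field_simp
    ring

lemma isogeny_mem_range_two (hb : b ≠ 0) {x y : ℚ}
    (h : (twoTorsionCurve (-4 * b)).toAffine.Nonsingular x y) (hx : x ≠ 0) (hsq : IsSquare x) :
    ∃ P, 2 • P = isogeny hb (.some x y h) := by
  obtain ⟨s, rfl⟩ := hsq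
  have hs : s ≠ 0 := by rintro rfl; simp at hx
  have E := equation_of_nonsingular h
  obtain ⟨w, rfl⟩ : ∃ w, y = s * w := ⟨y / s, by field_simp⟩
  have hw : w ^ 2 = s ^ 4 - 4 * b := by
    refine mul_left_cancel₀ (pow_ne_zero 2 hs) ?_
    linear_combination E
  obtain ⟨c, rfl⟩ : ∃ c, w = 2 * c - s ^ 2 := ⟨(s ^ 2 + w) / 2, by ring⟩
  obtain rfl : b = c * (s ^ 2 - c) := by linear_combination hw / 4
  have hc : c ≠ 0 := left_ne_zero_of_mul hb
  have h' : (twoTorsionCurve (c * (s ^ 2 - c))).toAffine.Nonsingular c (s * c) := by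
    rw [nonsingular_iff_equation hb]
    ring
  have h'' : (twoTorsionCurve (c * (s ^ 2 - c))).toAffine.Nonsingular c (-(s * c)) := by
    rw [nonsingular_iff_equation hb]
    ring
  refine ⟨.some _ _ h'', ?_⟩
  have hn : -Point.some _ _ h'' = Point.some c (s * c) h' := by
    rw [neg_some h'' (by simpa using h')]
    simp
  rw [two_nsmul, isogeny_some hb h hx, ← sub_eq_zero, ← neg_eq_zero]
  have := IsLine.add_eq_zero (b := c * (s ^ 2 - c)) (ℓ := (2 * c + s ^ 2) / (2 * s))
    (m := (s * c - (2 * c + s ^ 2) / (2 * s) * c)) (x₁ := c) (x₂ := c) ?_ h' h'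
    (nonsingular_isogeny hb h hx) (by ring) (by ring) ?_
  · rw [← hn] at this
    rw [← this]
    abel
  · constructor
    · field_simp
      ring
    · field_simp
      ring
    · field_simp
      ring
  · field_simp
    ring

lemma eval_addSubMap (s t u : ℚ) :
    (fun i ↦ (addSubMap (twoTorsionCurve b) i).eval ![s, t, u]) =
      ![s ^ 2 - 2 * b * s * u + b ^ 2 * u ^ 2, 2 * t * s + 2 * b * t * u, t ^ 2 - 4 * s * u] := by
  ext i
  fin_cases i <;>
    simp [addSubMap, WeierstrassCurve.b₂, WeierstrassCurve.b₄, WeierstrassCurve.b₆,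
      WeierstrassCurve.b₈]

lemma eval_addSubMap_sym2x_self (hb : b ≠ 0) (P : (twoTorsionCurve b).toAffine.Point) :
    ∃ c : ℚ, c ≠ 0 ∧ (fun i ↦ (addSubMap (twoTorsionCurve b) i).eval (P.sym2x P)) =
      c • (P + P).sym2x 0 := by
  rcases P with _ | ⟨x, y, h⟩
  · rw [← Point.zero_def, zero_add, Point.sym2x_zero_zero, eval_addSubMap]
    exact ⟨1, one_ne_zero, by simp⟩
  have E := equation_of_nonsingular h
  rw [Point.sym2x_some_some, eval_addSubMap]
  by_cases hy : y = 0
  · have hc : x ^ 2 - b ≠ 0 := by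
      intro h0
      apply deriv_ne_zero h hy
      subst hy
      obtain rfl : b = x ^ 2 := by linear_combination -h0
      have : x = 0 := by simpa using show x ^ 3 = 0 by linear_combination -E / 2
      simp [this]
    refine ⟨(x ^ 2 - b) ^ 2, pow_ne_zero 2 hc, ?_⟩
    rw [Point.add_of_Y_eq rfl (by simp [negY, hy]), Point.sym2x_zero_zero]
    subst hy
    simp only [Matrix.smul_cons, smul_eq_mul, Matrix.smul_empty]
    refine Matrix.vec3_eq ?_ ?_ ?_
    · ring
    · linear_combination -4 * E
    · ring
  · have hy' : y ≠ (twoTorsionCurve b).toAffine.negY x y := by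
      simp only [negY]
      intro h0
      exact hy (by linarith)
    refine ⟨4 * y ^ 2, by positivity, ?_⟩
    rw [Point.add_self_of_Y_ne hy', Point.sym2x_some_zero, slope_of_Y_ne rfl hy']
    simp only [Matrix.smul_cons, smul_eq_mul, Matrix.smul_empty, addX, negY]
    rw [show y - (-y - 0 * x - 0) = 2 * y by ring]
    refine Matrix.vec3_eq ?_ ?_ ?_
    · field_simp
      linear_combination 32 * x * E
    · linear_combination -4 * E
    · ring

lemma eval_addSubMap_sym2x (hb : b ≠ 0) (P Q : (twoTorsionCurve b).toAffine.Point) :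
    ∃ c : ℚ, c ≠ 0 ∧ (fun i ↦ (addSubMap (twoTorsionCurve b) i).eval (P.sym2x Q)) =
      c • (P + Q).sym2x (P - Q) := by
  by_cases hPQ : P = Q
  · subst hPQ
    rw [sub_self]
    exact eval_addSubMap_sym2x_self hb P
  by_cases hPQ' : P = -Q
  · subst hPQ'
    rw [neg_add_cancel, ← neg_add', Point.sym2x_neg_right, Point.sym2x_neg_left,
      Point.sym2x_comm 0]
    exact eval_addSubMap_sym2x_self hb Q
  rcases P with _ | ⟨x₁, y₁, h₁⟩
  · rw [← Point.zero_def, zero_add, zero_sub, Point.sym2x_neg_right]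
    rcases Q with _ | ⟨x₂, y₂, h₂⟩
    · exact absurd rfl hPQ
    rw [Point.sym2x_zero_some, Point.sym2x_some_some, eval_addSubMap]
    exact ⟨1, one_ne_zero, by simp; constructor <;> ring⟩
  rcases Q with _ | ⟨x₂, y₂, h₂⟩
  · rw [← Point.zero_def, add_zero, sub_zero, Point.sym2x_some_zero, Point.sym2x_some_some,
      eval_addSubMap]
    exact ⟨1, one_ne_zero, by simp; constructor <;> ring⟩
  have E₁ := equation_of_nonsingular h₁
  have E₂ := equation_of_nonsingular h₂
  have hx : x₁ ≠ x₂ := by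
    rintro rfl
    rcases Point.eq_or_eq_neg_of_xRep_eq_xRep (P := .some _ _ h₁) (Q := .some _ _ h₂) (by simp)
      with h | h
    · exact hPQ h
    · exact hPQ' h
  have hx' : x₁ - x₂ ≠ 0 := sub_ne_zero.2 hx
  refine ⟨(x₁ - x₂) ^ 2, by positivity, ?_⟩
  rw [sub_eq_add_neg (Point.some _ _ _), Point.neg_some, Point.add_of_X_ne hx, Point.add_of_X_ne hx,
    Point.sym2x_some_some, Point.sym2x_some_some, eval_addSubMap, slope_of_X_ne hx,
    slope_of_X_ne hx]
  simp only [Matrix.smul_cons, smul_eq_mul, Matrix.smul_empty, addX, negY]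
  refine Matrix.vec3_eq ?_ ?_ ?_
  · field_simp
    linear_combination 2 * (x₁ + x₂) * (x₁ - x₂) ^ 2 * (E₁ + E₂) -
      (E₁ - E₂) * (y₁ ^ 2 - y₂ ^ 2 + (x₁ ^ 3 + b * x₁) - (x₂ ^ 3 + b * x₂))
  · field_simp
    linear_combination -2 * (E₁ + E₂)
  · ring

lemma isElliptic (hb : b ≠ 0) : (twoTorsionCurve b).IsElliptic where
  isUnit := by
    simp [WeierstrassCurve.Δ, WeierstrassCurve.b₂, WeierstrassCurve.b₄, WeierstrassCurve.b₆,
      WeierstrassCurve.b₈, hb]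

/-- The naive height of the `x`-coordinate satisfies the approximate parallelogram law. -/
lemma exists_abs_logHeight_xRep_le (hb : b ≠ 0) :
    ∃ C, ∀ P Q : (twoTorsionCurve b).toAffine.Point,
      |logHeight (P + Q).xRep + logHeight (P - Q).xRep -
        2 * (logHeight P.xRep + logHeight Q.xRep)| ≤ C := by
  have : (twoTorsionCurve b).IsElliptic := isElliptic hb
  obtain ⟨C₁, h₁⟩ := abs_logHeight_addSubMap_sub_two_mul_logHeight_le (twoTorsionCurve b)
  obtain ⟨C₂, h₂⟩ := abs_logHeight_sym2_sub_le ℚ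
  have h₂ (P Q : (twoTorsionCurve b).toAffine.Point) :
      |logHeight (P.sym2x Q) - (logHeight P.xRep + logHeight Q.xRep)| ≤ C₂ := by
    have e (v : Fin 2 → ℚ) : v = ![v 0, v 1] := by
      ext i
      fin_cases i <;> rfl
    have hP := P.xRep_ne_zero
    have hQ := Q.xRep_ne_zero
    rw [e P.xRep] at hP
    rw [e Q.xRep] at hQ
    rw [Point.sym2x, e P.xRep, e Q.xRep]
    exact h₂ hP hQ
  refine ⟨C₁ + 3 * C₂, fun P Q ↦ ?_⟩
  obtain ⟨c, hc, h⟩ := eval_addSubMap_sym2x hb P Q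
  have h₃ := h₁ (P.sym2x Q)
  rw [h, logHeight_smul_eq_logHeight _ hc] at h₃
  have h₄ := h₂ P Q
  have h₅ := h₂ (P + Q) (P - Q)
  rw [abs_le] at *
  constructor <;> linarith

instance northcott_logHeight_xRep :
    Northcott fun P : (twoTorsionCurve b).toAffine.Point ↦ logHeight P.xRep where
  finite_le B := by
    have hfin := Northcott.finite_le (h := logHeight₁ (K := ℚ)) B
    have hsub : {P : (twoTorsionCurve b).toAffine.Point | logHeight P.xRep ≤ B} ⊆
        Point.xRep ⁻¹' (insert ![1, 0] ((fun x ↦ ![x, 1]) '' {x : ℚ | logHeight₁ x ≤ B})) := by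
      rintro (_ | ⟨x, y, h⟩) hP
      · left
        rfl
      · right
        exact ⟨x, by simpa [logHeight₁_eq_logHeight] using hP, rfl⟩
    refine Set.Finite.subset (Set.Finite.preimage' ((hfin.image _).insert _) fun v _ ↦ ?_) hsub
    by_cases hv : ∃ P : (twoTorsionCurve b).toAffine.Point, P.xRep = v
    · obtain ⟨P, rfl⟩ := hv
      refine (Set.toFinite {P, -P}).subset fun Q hQ ↦ ?_
      exact Point.eq_or_eq_neg_of_xRep_eq_xRep hQ
    · convert Set.finite_empty
      ext P
      simpa using fun h ↦ hv ⟨P, h⟩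

/-- If `E(ℚ) / 2E(ℚ)` is finite, then `E(ℚ)` is finitely generated. -/
theorem fg_of_finiteIndex (hb : b ≠ 0)
    (h : (nsmulAddMonoidHom (α := (twoTorsionCurve b).toAffine.Point) 2).range.FiniteIndex) :
    AddGroup.FG (twoTorsionCurve b).toAffine.Point :=
  have ⟨_, hC⟩ := exists_abs_logHeight_xRep_le hb
  AddCommGroup.fg_of_descent' h (fun _ ↦ logHeight_nonneg _) hC

end twoTorsionCurve

section Counting

open DirectSum

variable {A T : Type*} [AddCommGroup A] [AddCommGroup T] [Finite T] {n : ℕ}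

lemma rank_eq_of_equiv_finsupp_prod (f : A ≃+ (Fin n →₀ ℤ) × T) : Module.rank ℤ A = n := by
  let g : A →ₗ[ℤ] (Fin n →₀ ℤ) := ((AddMonoidHom.fst _ _).comp f.toAddMonoidHom).toIntLinearMap
  have hg : Function.Surjective g := fun v ↦ ⟨f.symm (v, 0), by simp [g]⟩
  have hker : Module.rank ℤ (LinearMap.ker g) = 0 := by
    rw [rank_eq_zero_iff]
    rintro ⟨a, ha⟩
    refine ⟨Nat.card T, mod_cast Nat.card_pos.ne', Subtype.ext (f.injective ?_)⟩
    have ha' : (f a).1 = 0 := ha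
    ext : 1
    · simp [ha']
    · simp
  have h := g.lift_rank_range_add_rank_ker
  rw [hker, LinearMap.range_eq_top.2 hg, rank_top, rank_finsupp_self] at h
  simpa using h.symm

lemma two_pow_mul_card_le_index_of_equiv (f : A ≃+ (Fin n →₀ ℤ) × T)
    [(nsmulAddMonoidHom (α := A) 2).range.FiniteIndex] {s : Finset A}
    (hs : ∀ a ∈ s, 2 • a = 0) :
    2 ^ n * s.card ≤ (nsmulAddMonoidHom (α := A) 2).range.index := by
  let q : (Fin n →₀ ℤ) →+ (Fin n → ZMod 2) :=
    ((Int.castAddHom (ZMod 2)).compLeft (Fin n)).comp Finsupp.coeFnAddHom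
  let Q := T ⧸ (nsmulAddMonoidHom (α := T) 2).range
  let φ : A →+ (Fin n → ZMod 2) × Q :=
    (q.prodMap (QuotientAddGroup.mk' (nsmulAddMonoidHom (α := T) 2).range)).comp f.toAddMonoidHom
  have hq : Function.Surjective q := fun v ↦ by
    choose w hw using fun i ↦ ZMod.intCast_surjective (v i)
    exact ⟨Finsupp.equivFunOnFinite.symm w, funext hw⟩
  have hφ : Function.Surjective φ :=
    (hq.prodMap (QuotientAddGroup.mk'_surjective (nsmulAddMonoidHom (α := T) 2).range)).comp
      f.surjective
  have hle : (nsmulAddMonoidHom (α := A) 2).range ≤ φ.ker := by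
    rintro _ ⟨a, rfl⟩
    have h1 (v : Fin n → ZMod 2) : 2 • v = 0 := by
      rw [two_nsmul]
      exact funext fun i ↦ CharTwo.add_self_eq_zero (v i)
    have h2 (v : Q) : 2 • v = 0 := by
      obtain ⟨t, rfl⟩ := QuotientAddGroup.mk'_surjective _ v
      rw [← map_nsmul]
      exact (QuotientAddGroup.eq_zero_iff _).2 ⟨t, rfl⟩
    simp [AddMonoidHom.mem_ker, Prod.ext_iff, h1, h2]
  have hcard : s.card ≤ Nat.card (nsmulAddMonoidHom (α := T) 2).ker := by
    have hf (a : s) : 2 • f a = 0 := by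
      rw [← map_nsmul, hs a a.2, map_zero]
    have hfst (a : s) : (f a).1 = 0 := by
      simpa using congrArg Prod.fst (hf a)
    rw [← Nat.card_eq_finsetCard]
    refine Nat.card_le_card_of_injective (fun a ↦ ⟨(f a).2, congrArg Prod.snd (hf a)⟩)
      fun a b hab ↦ ?_
    refine Subtype.ext (f.injective (Prod.ext ?_ (congrArg Subtype.val hab)))
    rw [hfst a, hfst b]
  calc 2 ^ n * s.card
    _ ≤ 2 ^ n * Nat.card (nsmulAddMonoidHom (α := T) 2).ker := by gcongr
    _ = Nat.card ((Fin n → ZMod 2) × Q) := by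
      rw [Nat.card_prod, ← AddSubgroup.index_range]
      simp [Q, AddSubgroup.index]
    _ = φ.ker.index := by
      rw [AddSubgroup.index_ker, AddMonoidHom.range_eq_top.2 hφ, AddSubgroup.card_top]
    _ ≤ _ := AddSubgroup.index_antitone hle

variable (A) in
/-- For a finitely generated abelian group `A` of rank `n`, the index of `2A` is at least
`2 ^ n` times the number of `2`-torsion elements. -/
theorem exists_rank_eq_and_two_pow_mul_le [AddGroup.FG A]
    [(nsmulAddMonoidHom (α := A) 2).range.FiniteIndex] :
    ∃ n : ℕ, Module.rank ℤ A = n ∧ ∀ s : Finset A, (∀ a ∈ s, 2 • a = 0) →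
      2 ^ n * s.card ≤ (nsmulAddMonoidHom (α := A) 2).range.index := by
  obtain ⟨n, ι, _, p, hp, e, ⟨f⟩⟩ := AddCommGroup.equiv_free_prod_directSum_zmod A
  have (i : ι) : NeZero (p i ^ e i) := ⟨pow_ne_zero _ (hp i).ne_zero⟩
  have : Finite (⨁ i, ZMod (p i ^ e i)) :=
    Finite.of_equiv _ (DirectSum.addEquivProd fun i ↦ ZMod (p i ^ e i)).symm.toEquiv
  exact ⟨n, rank_eq_of_equiv_finsupp_prod f, fun _ ↦ two_pow_mul_card_le_index_of_equiv f⟩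

/-- The index bound of a descent by an isogeny `ψ : B → A`. -/
theorem finiteIndex_and_index_le_of_ker_le_range {B G : Type*} [AddCommGroup B]
    [AddCommGroup G] [Finite G] (hG : ∀ g : G, g + g = 0)
    (ψ : B →+ A) (α : A →+ G) (hα : α.ker ≤ ψ.range)
    [((nsmulAddMonoidHom (α := A) 2).range.comap ψ).FiniteIndex] :
    (nsmulAddMonoidHom (α := A) 2).range.FiniteIndex ∧
    (nsmulAddMonoidHom (α := A) 2).range.index ≤
      Nat.card G * ((nsmulAddMonoidHom (α := A) 2).range.comap ψ).index := by
  have h : (nsmulAddMonoidHom (α := A) 2).range ≤ ψ.range := by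
    rintro _ ⟨a, rfl⟩
    exact hα (by simp [AddMonoidHom.mem_ker, two_nsmul, hG])
  have : ψ.range.FiniteIndex := AddSubgroup.finiteIndex_of_le hα
  have hindex : (nsmulAddMonoidHom (α := A) 2).range.index =
      ψ.range.index * ((nsmulAddMonoidHom (α := A) 2).range.comap ψ).index := by
    rw [← AddSubgroup.relIndex_mul_index h, AddSubgroup.index_comap, mul_comm]
  refine ⟨⟨?_⟩, ?_⟩
  · rw [hindex]
    exact mul_ne_zero AddSubgroup.FiniteIndex.index_ne_zero AddSubgroup.FiniteIndex.index_ne_zero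
  rw [hindex]
  gcongr
  calc ψ.range.index ≤ α.ker.index := AddSubgroup.index_antitone hα
    _ = Nat.card α.range := AddSubgroup.index_ker α
    _ ≤ Nat.card G := Nat.card_le_card_of_injective _ Subtype.val_injective

end Counting

section Valuations

lemma padicValRat_eq_one_of_squarefree {n p : ℕ} (hp : p.Prime) (hn : Squarefree n) (h : p ∣ n) :
    padicValRat p n = 1 := by
  rw [padicValRat.of_nat, ← Nat.factorization_def n hp]
  have h₁ := hn.natFactorization_le_one p
  have h₂ := (hp.dvd_iff_one_le_factorization hn.ne_zero).1 h
  exact_mod_cast le_antisymm h₁ h₂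

lemma padicValRat_eq_zero_of_not_dvd {n p : ℕ} (h : ¬p ∣ n) : padicValRat p n = 0 := by
  rw [padicValRat.of_nat, padicValNat.eq_zero_of_not_dvd h, Nat.cast_zero]

lemma isSquare_of_even_padicValRat {x : ℚ} (hx : 0 < x)
    (h : ∀ p : ℕ, p.Prime → Even (padicValRat p x)) : IsSquare x := by
  obtain ⟨a, r, hN, ha⟩ := Nat.sq_mul_squarefree (x.num.toNat * x.den)
  have hden : (x.den : ℚ) ≠ 0 := by exact_mod_cast x.den_nz
  have hN' : (r : ℚ) ^ 2 * a = x * x.den ^ 2 := by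
    have h₁ : ((x.num.toNat : ℤ) : ℚ) = x.num := by
      rw [Int.toNat_of_nonneg (Rat.num_nonneg.2 hx.le)]
    have h₂ : (r : ℚ) ^ 2 * a = (x.num.toNat : ℤ) * x.den := by exact_mod_cast hN
    rw [h₂, h₁, sq, ← mul_assoc, Rat.mul_den_eq_num]
  have hr : (r : ℚ) ≠ 0 := by
    rintro h0
    rw [h0] at hN'
    have : x * x.den ^ 2 ≠ 0 := by positivity
    simp_all
  have ha0 : (a : ℚ) ≠ 0 := by exact_mod_cast ha.ne_zero
  obtain rfl : a = 1 := by
    by_contra ha1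
    obtain ⟨p, hp, hpa⟩ := Nat.exists_prime_and_dvd ha1
    have : Fact p.Prime := ⟨hp⟩
    have hv := congrArg (padicValRat p) hN'
    rw [padicValRat.mul (pow_ne_zero _ hr) ha0, padicValRat.mul hx.ne' (pow_ne_zero _ hden),
      padicValRat.pow, padicValRat.pow, padicValRat_eq_one_of_squarefree hp ha hpa] at hv
    obtain ⟨k, hk⟩ := h p hp
    push_cast at hv
    omega
  refine ⟨r / x.den, ?_⟩
  field_simp
  linear_combination -hN'

lemma even_padicValRat_of_equation {p : ℕ} [Fact p.Prime] {b x y : ℚ} (hb : b ≠ 0)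
    (hpb : padicValRat p b = 0) (hx : x ≠ 0) (h : y ^ 2 = x ^ 3 + b * x) :
    Even (padicValRat p x) := by
  by_cases hs : x ^ 2 + b = 0
  · have hv := congrArg (padicValRat p) (eq_neg_of_add_eq_zero_left hs)
    rw [padicValRat.pow, padicValRat.neg, hpb] at hv
    simp_all
  have hx2 : x ^ 2 ≠ 0 := pow_ne_zero 2 hx
  have hy : y ≠ 0 := by
    rintro rfl
    exact mul_ne_zero hx hs (by linear_combination -h)
  have hv := congrArg (padicValRat p) (show y ^ 2 = x * (x ^ 2 + b) by rw [h]; ring)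
  rw [padicValRat.pow, padicValRat.mul hx hs] at hv
  by_cases h0 : padicValRat p x = 0
  · simp [h0]
  have hpow : padicValRat p (x ^ 2) = 2 * padicValRat p x := by
    rw [padicValRat.pow]
    rfl
  rw [padicValRat.add_eq_min hs hx2 hb (by omega), hpow, hpb] at hv
  push_cast at hv
  rw [Int.even_iff]
  omega

/-- The parities of the valuations at the prime divisors of `n`. -/
noncomputable def valuationParity (n : ℕ) (x : ℚ) : n.primeFactors → ZMod 2 :=
  fun p ↦ (padicValRat p x : ZMod 2)

lemma valuationParity_mul (n : ℕ) {x y : ℚ} (hx : x ≠ 0) (hy : y ≠ 0) :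
    valuationParity n (x * y) = valuationParity n x + valuationParity n y := by
  ext p
  have : Fact (p : ℕ).Prime := ⟨Nat.prime_of_mem_primeFactors p.2⟩
  simp [valuationParity, padicValRat.mul hx hy]

/-- The sign, as an element of `ZMod 2`, together with the parities of the valuations at the
prime divisors of `n`. -/
noncomputable def signValuationParity (n : ℕ) (x : ℚ) : ZMod 2 × (n.primeFactors → ZMod 2) :=
  (if x < 0 then 1 else 0, valuationParity n x)

lemma signValuationParity_mul (n : ℕ) {x y : ℚ} (hx : x ≠ 0) (hy : y ≠ 0) :
    signValuationParity n (x * y) = signValuationParity n x + signValuationParity n y := by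
  refine Prod.ext ?_ (valuationParity_mul n hx hy)
  rcases hx.lt_or_gt with hx | hx <;> rcases hy.lt_or_gt with hy | hy
  · simpa [signValuationParity, hx, hy, (mul_pos_of_neg_of_neg hx hy).not_gt] using
      (CharTwo.add_self_eq_zero (1 : ZMod 2)).symm
  · simp [signValuationParity, hx, hy.not_gt, mul_neg_of_neg_of_pos hx hy]
  · simp [signValuationParity, hx.not_gt, hy, mul_neg_of_pos_of_neg hx hy]
  · simp [signValuationParity, hx.not_gt, hy.not_gt, (mul_pos hx hy).not_gt]

lemma isSquare_of_valuationParity_eq_zero {n : ℕ} (hn : n ≠ 0) {b x y : ℚ} (hb : b ≠ 0)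
    (hnb : ∀ p : ℕ, p.Prime → ¬p ∣ n → padicValRat p b = 0) (hx : 0 < x)
    (h : y ^ 2 = x ^ 3 + b * x) (hv : valuationParity n x = 0) : IsSquare x := by
  refine isSquare_of_even_padicValRat hx fun p hp ↦ ?_
  have : Fact p.Prime := ⟨hp⟩
  by_cases hpn : p ∣ n
  · have := congrFun hv ⟨p, Nat.mem_primeFactors.2 ⟨hp, hpn, hn⟩⟩
    exact ZMod.intCast_eq_zero_iff_even.1 this
  · exact even_padicValRat_of_equation hb (hnb p hp hpn) hx.ne' h

end Valuations

namespace twoTorsionCurve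

variable {b : ℚ}

lemma some_zero_add_self {x : ℚ} (h : (twoTorsionCurve b).toAffine.Nonsingular x 0) :
    2 • Point.some x 0 h = 0 := by
  rw [two_nsmul]
  exact Point.add_of_Y_eq rfl (by simp [negY])

section Descent

variable {n : ℕ}

/-- The descent map on `y² = x³ + bx` for `b < 0`. -/
noncomputable def signDescent (n : ℕ) (hb : b ≠ 0) :
    (twoTorsionCurve b).toAffine.Point →+ ZMod 2 × (n.primeFactors → ZMod 2) :=
  xHom hb (signValuationParity n) (fun _ _ ↦ signValuationParity_mul n)
    fun _ ↦ Prod.ext (CharTwo.add_self_eq_zero _) (funext fun _ ↦ CharTwo.add_self_eq_zero _)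

/-- The descent map on `y² = x³ + bx` for `b > 0`. -/
noncomputable def descent (n : ℕ) (hb : b ≠ 0) :
    (twoTorsionCurve b).toAffine.Point →+ (n.primeFactors → ZMod 2) :=
  xHom hb (valuationParity n) (fun _ _ ↦ valuationParity_mul n)
    fun _ ↦ funext fun _ ↦ CharTwo.add_self_eq_zero _

lemma ker_signDescent_le (hn : n ≠ 0) (hb : b < 0)
    (hnb : ∀ p : ℕ, p.Prime → ¬p ∣ n → padicValRat p b = 0) :
    (signDescent n hb.ne).ker ≤ (isogeny hb.ne).range := by
  rintro (_ | ⟨x, y, h⟩) hP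
  · exact zero_mem _
  rw [AddMonoidHom.mem_ker] at hP
  by_cases hx : x = 0
  · subst hx
    rw [signDescent, xHom_some_zero] at hP
    simpa [signValuationParity, hb] using congrArg Prod.fst hP
  rw [signDescent, xHom_some _ _ _ _ _ hx] at hP
  have hpos : 0 < x := by
    by_contra hneg
    have hneg : x < 0 := lt_of_le_of_ne (not_lt.1 hneg) hx
    simpa [signValuationParity, hneg] using congrArg Prod.fst hP
  exact some_mem_range_isogeny hb.ne h hx <| isSquare_of_valuationParity_eq_zero hn hb.ne hnb hpos
    (equation_of_nonsingular h) (congrArg Prod.snd hP)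

lemma ker_descent_le (hn : n ≠ 0) (hb : b < 0)
    (hnb : ∀ p : ℕ, p.Prime → ¬p ∣ n → padicValRat p (-4 * b) = 0) :
    (descent n (mul_ne_zero (by norm_num : (-4 : ℚ) ≠ 0) hb.ne)).ker ≤
      (nsmulAddMonoidHom (α := (twoTorsionCurve b).toAffine.Point) 2).range.comap
        (isogeny hb.ne) := by
  rintro (_ | ⟨x, y, h⟩) hP
  · exact zero_mem _
  rw [AddMonoidHom.mem_ker] at hP
  rw [AddSubgroup.mem_comap]
  by_cases hx : x = 0
  · subst hx
    rw [isogeny_some_zero]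
    exact zero_mem _
  rw [descent, xHom_some _ _ _ _ _ hx] at hP
  have E := equation_of_nonsingular h
  have hpos : 0 < x := by
    refine lt_of_le_of_ne (nonneg_of_mul_nonneg_left ?_ (show 0 < x ^ 2 + -4 * b by nlinarith))
      (Ne.symm hx)
    rw [show x * (x ^ 2 + -4 * b) = y ^ 2 by rw [E]; ring]
    positivity
  exact isogeny_mem_range_two hb.ne h hx <| isSquare_of_valuationParity_eq_zero hn
    (mul_ne_zero (by norm_num) hb.ne) hnb hpos E hP

end Descent

end twoTorsionCurve

section Rank

open twoTorsionCurve

variable {d D : ℕ}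

lemma padicValRat_mul_sq_of_not_dvd {p : ℕ} [Fact p.Prime] (hd : d ≠ 0) (hD : D ∣ d)
    (hp : ¬p ∣ d) : padicValRat p (d * D ^ 2 : ℚ) = 0 := by
  have hD0 : D ≠ 0 := ne_zero_of_dvd_ne_zero hd hD
  rw [padicValRat.mul (by exact_mod_cast hd) (by exact_mod_cast pow_ne_zero 2 hD0),
    padicValRat.pow, padicValRat_eq_zero_of_not_dvd hp,
    padicValRat_eq_zero_of_not_dvd fun h ↦ hp (h.trans hD)]
  simp

lemma padicValRat_four_mul (p : ℕ) [Fact p.Prime] {x : ℚ} (hx : x ≠ 0) :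
    padicValRat p (4 * x) = 2 * padicValRat p (2 : ℕ) + padicValRat p x := by
  rw [show (4 : ℚ) * x = ((2 : ℕ) : ℚ) ^ 2 * x by norm_num, padicValRat.mul (by norm_num) hx,
    padicValRat.pow]
  rfl

lemma valuationParity_four_mul_ne_zero (hsf : Squarefree d) (hD : D ≠ 0) (hd : d ≠ 1) :
    valuationParity (2 * d) (4 * (d * D ^ 2)) ≠ 0 := by
  have hd0 := hsf.ne_zero
  obtain ⟨p, hp, hpd⟩ := Nat.exists_prime_and_dvd hd
  have : Fact p.Prime := ⟨hp⟩
  intro h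
  have := congrFun h ⟨p, Nat.mem_primeFactors.2 ⟨hp, hpd.mul_left 2, by simpa using hd0⟩⟩
  have h2 := ZMod.intCast_eq_zero_iff_even.1 this
  rw [padicValRat_four_mul p (by positivity), padicValRat.mul (by positivity) (by positivity),
    padicValRat.pow, padicValRat_eq_one_of_squarefree hp hsf hpd, Int.even_iff] at h2
  push_cast at h2
  omega

/-- The number of classes modulo `2E(ℚ)` for `E : y² = x³ - dD²x`, with the extra factor coming
from the point `(0, 0)` on the isogenous curve. -/
lemma finiteIndex_and_index_le (hd : Odd d) (hsf : Squarefree d) (hD : D ∣ d) :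
    (nsmulAddMonoidHom
      (α := (twoTorsionCurve (-((d : ℚ) * (D : ℚ) ^ 2))).toAffine.Point) 2).range.FiniteIndex ∧
    (if d = 1 then 1 else 2) * (nsmulAddMonoidHom
      (α := (twoTorsionCurve (-((d : ℚ) * (D : ℚ) ^ 2))).toAffine.Point) 2).range.index ≤
      2 ^ (2 * d.primeFactors.card + 2) := by
  have hd0 := hsf.ne_zero
  have hD0 : D ≠ 0 := ne_zero_of_dvd_ne_zero hd0 hD
  have hb : -((d : ℚ) * (D : ℚ) ^ 2) < 0 := by
    rw [neg_lt_zero]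
    positivity
  have hb4 : -4 * -((d : ℚ) * (D : ℚ) ^ 2) = 4 * (d * D ^ 2) := by ring
  have hα := ker_signDescent_le hd0 hb fun p hp hpd ↦ by
    have : Fact p.Prime := ⟨hp⟩
    rw [padicValRat.neg, padicValRat_mul_sq_of_not_dvd hd0 hD hpd]
  have hβ := ker_descent_le (n := 2 * d) (by positivity) hb fun p hp hpd ↦ by
    have : Fact p.Prime := ⟨hp⟩
    rw [hb4, padicValRat_four_mul p (by positivity),
      padicValRat_mul_sq_of_not_dvd hd0 hD fun h ↦ hpd (h.mul_left 2),
      padicValRat_eq_zero_of_not_dvd fun h ↦ hpd (h.mul_right d)]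
    simp
  set K := (nsmulAddMonoidHom
    (α := (twoTorsionCurve (-((d : ℚ) * (D : ℚ) ^ 2))).toAffine.Point) 2).range
  set β := descent (2 * d) (mul_ne_zero (by norm_num : (-4 : ℚ) ≠ 0) hb.ne)
  set ψ := isogeny hb.ne
  have hfin : (K.comap ψ).FiniteIndex := AddSubgroup.finiteIndex_of_le hβ
  have hcard : β.ker.index ≤ 2 ^ (d.primeFactors.card + 1) := by
    have hpf : (2 * d).primeFactors.card = d.primeFactors.card + 1 := by
      rw [Nat.Coprime.primeFactors_mul (Nat.coprime_two_left.2 hd),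
        Finset.card_union_of_disjoint (Nat.coprime_two_left.2 hd).disjoint_primeFactors,
        Nat.prime_two.primeFactors, Finset.card_singleton, add_comm]
    calc β.ker.index = Nat.card β.range := AddSubgroup.index_ker β
      _ ≤ Nat.card ((2 * d).primeFactors → ZMod 2) :=
        Nat.card_le_card_of_injective _ Subtype.val_injective
      _ = 2 ^ (d.primeFactors.card + 1) := by
        rw [Nat.card_fun, Nat.card_zmod, Nat.card_eq_finsetCard, hpf]
  have hcomap : (if d = 1 then 1 else 2) * (K.comap ψ).index ≤ 2 ^ (d.primeFactors.card + 1) := by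
    refine le_trans ?_ hcard
    split_ifs with h1
    · rw [one_mul]
      exact AddSubgroup.index_antitone hβ
    · have h0 : (twoTorsionCurve (-4 * -((d : ℚ) * (D : ℚ) ^ 2))).toAffine.Nonsingular 0 0 :=
        (nonsingular_iff_equation (mul_ne_zero (by norm_num) hb.ne)).2 (by ring)
      have hlt : β.ker < K.comap ψ := by
        refine lt_of_le_of_ne hβ fun h ↦ ?_
        have hmem : Point.some 0 0 h0 ∈ K.comap ψ := by
          rw [AddSubgroup.mem_comap, isogeny_some_zero]
          exact zero_mem _
        rw [← h, AddMonoidHom.mem_ker] at hmem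
        refine valuationParity_four_mul_ne_zero hsf hD0 h1 ?_
        rw [← hb4]
        exact (xHom_some_zero _ _ _ _ h0).symm.trans hmem
      obtain ⟨k, hk⟩ := AddSubgroup.index_dvd_of_le hβ
      have hlt' := AddSubgroup.index_strictAnti hlt
      rw [hk, mul_comm]
      gcongr
      by_contra! hk2
      interval_cases k <;> omega
  obtain ⟨hK, hle⟩ := finiteIndex_and_index_le_of_ker_le_range
    (fun _ ↦ Prod.ext (CharTwo.add_self_eq_zero _) (funext fun _ ↦ CharTwo.add_self_eq_zero _))
    ψ (signDescent d hb.ne) hα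
  refine ⟨hK, ?_⟩
  calc (if d = 1 then 1 else 2) * K.index
    _ ≤ (if d = 1 then 1 else 2) *
        (Nat.card (ZMod 2 × (d.primeFactors → ZMod 2)) * (K.comap ψ).index) := by gcongr
    _ = 2 ^ (d.primeFactors.card + 1) * ((if d = 1 then 1 else 2) * (K.comap ψ).index) := by
      rw [Nat.card_prod, Nat.card_fun, Nat.card_zmod, Nat.card_eq_finsetCard]
      ring
    _ ≤ 2 ^ (d.primeFactors.card + 1) * 2 ^ (d.primeFactors.card + 1) := by gcongr
    _ = 2 ^ (2 * d.primeFactors.card + 2) := by ring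

/-- The curve `y² = x³ - dD²x` has at least `2` rational `2`-torsion points, and `4` if `d = 1`. -/
lemma exists_finset_two_nsmul_eq_zero (hd : d ≠ 0) (hD : D ∣ d) :
    ∃ s : Finset (twoTorsionCurve (-((d : ℚ) * (D : ℚ) ^ 2))).toAffine.Point,
      (∀ P ∈ s, 2 • P = 0) ∧ 4 ≤ (if d = 1 then 1 else 2) * s.card := by
  classical
  have hD0 : D ≠ 0 := ne_zero_of_dvd_ne_zero hd hD
  have hb : -((d : ℚ) * (D : ℚ) ^ 2) ≠ 0 := by
    rw [neg_ne_zero]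
    positivity
  have h0 : (twoTorsionCurve (-((d : ℚ) * (D : ℚ) ^ 2))).toAffine.Nonsingular 0 0 :=
    (nonsingular_iff_equation hb).2 (by ring)
  split_ifs with h1
  · obtain rfl : D = 1 := by simpa [h1] using hD
    have hp : (twoTorsionCurve (-((d : ℚ) * ((1 : ℕ) : ℚ) ^ 2))).toAffine.Nonsingular 1 0 :=
      (nonsingular_iff_equation hb).2 (by simp [h1])
    have hn : (twoTorsionCurve (-((d : ℚ) * ((1 : ℕ) : ℚ) ^ 2))).toAffine.Nonsingular (-1) 0 :=
      (nonsingular_iff_equation hb).2 (by rw [h1]; norm_num)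
    refine ⟨{0, .some 0 0 h0, .some 1 0 hp, .some (-1) 0 hn}, ?_, ?_⟩
    · simp [some_zero_add_self]
    · rw [Finset.card_insert_of_notMem, Finset.card_insert_of_notMem, Finset.card_pair] <;>
        norm_num [(Point.some_ne_zero h0).symm, (Point.some_ne_zero hp).symm,
          (Point.some_ne_zero hn).symm]
  · refine ⟨{0, .some 0 0 h0}, by simp [some_zero_add_self], ?_⟩
    rw [Finset.card_pair (Point.some_ne_zero h0).symm]

end Rank

/-- For an odd squarefree positive integer `d` and a positive divisor `D` of `d`, the rank of
the group of rational points of the elliptic curve `y² = x³ − dD²x` is at most `2·ω(d)`. -/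
theorem rank_le_of_twisted_curve (d D : ℕ) (hd : Odd d) (hsf : Squarefree d) (hdpos : 0 < d)
    (hD : D ∣ d) (hDpos : 0 < D) :
    Module.rank ℤ
        (({ a₁ := 0, a₂ := 0, a₃ := 0, a₄ := -((d : ℚ) * (D : ℚ) ^ 2), a₆ := 0 } :
          WeierstrassCurve ℚ).toAffine.Point) ≤
      ((2 * d.primeFactors.card : ℕ) : Cardinal) := by
  change Module.rank ℤ (twoTorsionCurve (-((d : ℚ) * (D : ℚ) ^ 2))).toAffine.Point ≤ _
  have hb : -((d : ℚ) * (D : ℚ) ^ 2) ≠ 0 := by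
    rw [neg_ne_zero]
    positivity
  obtain ⟨hfin, hindex⟩ := finiteIndex_and_index_le hd hsf hD
  have := twoTorsionCurve.fg_of_finiteIndex hb hfin
  obtain ⟨n, hn, hle⟩ :=
    exists_rank_eq_and_two_pow_mul_le (twoTorsionCurve (-((d : ℚ) * (D : ℚ) ^ 2))).toAffine.Point
  obtain ⟨s, hs, hcard⟩ := exists_finset_two_nsmul_eq_zero hdpos.ne' hD
  rw [hn, Nat.cast_le]
  have h : 2 ^ (n + 2) ≤ 2 ^ (2 * d.primeFactors.card + 2) := calc
    2 ^ (n + 2) = 2 ^ n * 4 := by ring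
    _ ≤ 2 ^ n * ((if d = 1 then 1 else 2) * s.card) := by gcongr
    _ = (if d = 1 then 1 else 2) * (2 ^ n * s.card) := by ring
    _ ≤ _ := le_trans (by gcongr; exact hle s hs) hindex
  have := (Nat.pow_le_pow_iff_right (by norm_num)).1 h
  omega
end

section
/- Let q be an odd prime and let d be an integer not divisible by q such that d is not a square modulo q. Then 4 divides q + 1 − #E(F_q), where E is the curve y² = x³ − dx over F_q. -/
section

variable {F : Type*} [Field F] [Fintype F] [DecidableEq F]

/-- The number of points of a nonsingular curve `y² = x³ + ax` in terms of the quadratic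
character. -/
theorem card_point_eq_add_sum_quadraticChar (hF : ringChar F ≠ 2) (a : F) (ha : a ≠ 0) :
    (Nat.card (({ a₁ := 0, a₂ := 0, a₃ := 0, a₄ := a, a₆ := 0 } :
      WeierstrassCurve F).toAffine.Point) : ℤ) =
      Fintype.card F + 1 + ∑ x : F, quadraticChar F (x ^ 3 + a * x) := by
  set W : WeierstrassCurve F := { a₁ := 0, a₂ := 0, a₃ := 0, a₄ := a, a₆ := 0 } with hW
  have hΔ : W.toAffine.Δ ≠ 0 := by
    have h2 : (2 : F) ≠ 0 := Ring.two_ne_zero hF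
    have : W.toAffine.Δ = -(2 ^ 6 * a ^ 3) := by
      simp only [hW, WeierstrassCurve.Δ, WeierstrassCurve.b₂, WeierstrassCurve.b₄,
        WeierstrassCurve.b₆, WeierstrassCurve.b₈]
      ring
    rw [this]
    exact neg_ne_zero.mpr (mul_ne_zero (pow_ne_zero _ h2) (pow_ne_zero _ ha))
  have hiff (x y : F) : W.toAffine.Nonsingular x y ↔ y ^ 2 = x ^ 3 + a * x := by
    rw [← W.toAffine.equation_iff_nonsingular_of_Δ_ne_zero hΔ,
      WeierstrassCurve.Affine.equation_iff]
    simp [hW]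
  let e : W.toAffine.Point ≃ Option (Σ x : F, {y : F | y ^ 2 = x ^ 3 + a * x}) :=
    { toFun := fun P => match P with
        | .zero => none
        | .some x y h => some ⟨x, y, (hiff x y).mp h⟩
      invFun := fun P => match P with
        | none => .zero
        | some ⟨x, y, h⟩ => .some x y ((hiff x y).mpr h)
      left_inv := by rintro (_ | _) <;> rfl
      right_inv := by rintro (_ | _) <;> rfl }
  rw [Nat.card_congr e, Nat.card_eq_fintype_card, Fintype.card_option, Fintype.card_sigma]
  push_cast
  simp only [← Set.toFinset_card, quadraticChar_card_sqrts hF, Finset.sum_add_distrib]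
  simp
  ring

/-- If `d` is not a square, then `∑ₓ χ(x³ - dx)` is divisible by `4`. -/
theorem four_dvd_sum_quadraticChar_cube_sub (hF : ringChar F ≠ 2) {d : F} (hd : ¬ IsSquare d) :
    (4 : ℤ) ∣ ∑ x : F, quadraticChar F (x ^ 3 + -d * x) := by
  have hneg (x : F) : quadraticChar F ((-x) ^ 3 + -d * -x) =
      quadraticChar F (-1) * quadraticChar F (x ^ 3 + -d * x) := by
    rw [← map_mul]
    congr 1
    ring
  have hodd := FiniteField.odd_card_of_char_ne_two hF
  by_cases h1 : IsSquare (-1 : F)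
  · have hχ := (quadraticChar_one_iff_isSquare (neg_ne_zero.mpr (one_ne_zero' F))).mpr h1
    have hcard := FiniteField.isSquare_neg_one_iff.mp h1
    simp only [hχ, one_mul] at hneg
    have hroot (x : F) (hx : x ≠ 0) : x ^ 3 + -d * x ≠ 0 := by
      intro h
      refine hd ⟨x, mul_right_cancel₀ hx ?_⟩
      linear_combination -h
    let g (x : F) : ℤ := if quadraticChar F (x ^ 3 + -d * x) = 1 then 1 else 0
    have hg (x : F) (hx : x ≠ 0) : quadraticChar F (x ^ 3 + -d * x) = 2 * g x - 1 := by
      rcases quadraticChar_dichotomy (hroot x hx) with h | h <;>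
        simp only [g, h] <;> norm_num
    have heven : (2 : ℤ) ∣ ∑ x ∈ Finset.univ.erase (0 : F), g x := by
      refine (ZMod.intCast_zmod_eq_zero_iff_dvd _ 2).mp ?_
      rw [Int.cast_sum]
      refine Finset.sum_involution (fun x _ => -x) (fun x _ => ?_) (fun x hx _ h => ?_)
        (fun x hx => by simpa using hx) (fun x _ => neg_neg x)
      · simp only [g, hneg]
        exact CharTwo.add_self_eq_zero _
      · exact Finset.ne_of_mem_erase hx ((Ring.eq_self_iff_eq_zero_of_char_ne_two hF).mp h)
    have hsum : ∑ x : F, quadraticChar F (x ^ 3 + -d * x) =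
        2 * ∑ x ∈ Finset.univ.erase (0 : F), g x - (Fintype.card F - 1 : ℤ) := by
      rw [← Finset.add_sum_erase _ _ (Finset.mem_univ (0 : F)),
        Finset.sum_congr rfl fun x hx => hg x (Finset.ne_of_mem_erase hx),
        Finset.sum_sub_distrib, ← Finset.mul_sum, Finset.sum_const,
        Finset.card_erase_of_mem (Finset.mem_univ _), Finset.card_univ, nsmul_one,
        Nat.cast_sub Fintype.card_pos]
      simp
    lia
  · simp only [quadraticChar_neg_one_iff_not_isSquare.mpr h1, neg_one_mul] at hneg
    have h := Equiv.sum_comp (Equiv.neg F) fun x => quadraticChar F (x ^ 3 + -d * x)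
    simp only [Equiv.neg_apply, hneg, Finset.sum_neg_distrib] at h
    lia

end

/-- If `q` is an odd prime and `d` is not divisible by `q` and not a square mod `q`, then
`4` divides `q + 1 − #E(F_q)` for `E : y² = x³ − dx` over `F_q`. -/
theorem four_dvd_trace_of_nonsquare (q : ℕ) (hq : q.Prime) (hqodd : Odd q)
    (d : ℤ) (hqd : ¬ ((q : ℤ) ∣ d)) (hns : ¬ IsSquare (d : ZMod q)) :
    (4 : ℤ) ∣ (q : ℤ) + 1 -
      (Nat.card (({ a₁ := 0, a₂ := 0, a₃ := 0, a₄ := -(d : ZMod q), a₆ := 0 } :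
        WeierstrassCurve (ZMod q)).toAffine.Point) : ℤ) := by
  have : Fact q.Prime := ⟨hq⟩
  have hF : ringChar (ZMod q) ≠ 2 := by
    rw [ZMod.ringChar_zmod_n]
    rintro rfl
    exact absurd hqodd (by decide)
  have hd : -(d : ZMod q) ≠ 0 :=
    neg_ne_zero.mpr fun h => hqd ((ZMod.intCast_zmod_eq_zero_iff_dvd d q).mp h)
  rw [card_point_eq_add_sum_quadraticChar hF _ hd, ZMod.card, sub_add_cancel_left]
  exact (four_dvd_sum_quadraticChar_cube_sub hF hns).neg_right
end

section
/- Let q be an odd prime and let d be an integer not divisible by q. Let E : y² = x³ − d²x over F_q and set a = q + 1 − #E(F_q). Then 16 divides (q − 1)(q + 1 − a)(q + 1 + a). -/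
/-- The Weierstrass curve `y² = x³ − c²x`. -/
abbrev congruentCurve {F : Type*} [Field F] (c : F) : WeierstrassCurve F :=
  { a₁ := 0, a₂ := 0, a₃ := 0, a₄ := -c ^ 2, a₆ := 0 }

namespace congruentCurve

variable {F : Type*} [Field F] {c : F}

lemma nonsingular_zero (hc : c ≠ 0) {x : F} (hx : x = 0 ∨ x = c ∨ x = -c) (h2 : (2 : F) ≠ 0) :
    (congruentCurve c).toAffine.Nonsingular x 0 := by
  rw [WeierstrassCurve.Affine.nonsingular_iff, WeierstrassCurve.Affine.equation_iff]
  rcases hx with rfl | rfl | rfl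
  · simp [hc]
  · refine ⟨by ring, Or.inl fun h ↦ ?_⟩
    exact mul_ne_zero h2 (pow_ne_zero 2 hc) (by linear_combination -h)
  · refine ⟨by ring, Or.inl fun h ↦ ?_⟩
    exact mul_ne_zero h2 (pow_ne_zero 2 hc) (by linear_combination -h)

/-- The curve `y² = x³ − c²x` has exactly four points killed by `2`. -/
lemma card_ker_two [DecidableEq F] (hc : c ≠ 0) (h2 : (2 : F) ≠ 0) :
    Nat.card (nsmulAddMonoidHom (α := (congruentCurve c).toAffine.Point) 2).ker = 4 := by
  have hcc : c ≠ -c := fun h ↦ mul_ne_zero h2 hc (by linear_combination h)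
  have h_ker : ((nsmulAddMonoidHom (α := (congruentCurve c).toAffine.Point) 2).ker :
      Set (congruentCurve c).toAffine.Point) =
      {0, .some _ _ (nonsingular_zero hc (Or.inl rfl) h2),
        .some _ _ (nonsingular_zero hc (Or.inr (Or.inl rfl)) h2),
        .some _ _ (nonsingular_zero hc (Or.inr (Or.inr rfl)) h2)} := by
    ext P
    simp only [SetLike.mem_coe, AddMonoidHom.mem_ker, nsmulAddMonoidHom_apply, two_nsmul,
      add_eq_zero_iff_eq_neg, Set.mem_insert_iff, Set.mem_singleton_iff]
    rcases P with _ | ⟨x, y, h⟩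
    · simp [← WeierstrassCurve.Affine.Point.zero_def]
    · have h_eq := (WeierstrassCurve.Affine.equation_iff _ _).mp h.left
      simp only [WeierstrassCurve.Affine.Point.neg_some, WeierstrassCurve.Affine.Point.some.injEq,
        WeierstrassCurve.Affine.negY, true_and, WeierstrassCurve.Affine.Point.some_ne_zero,
        false_or]
      constructor
      · intro hy
        have hy0 : y = 0 := (mul_eq_zero_iff_left h2).mp (by linear_combination hy)
        subst hy0
        have hx : x * ((x - c) * (x + c)) = 0 := by linear_combination -h_eq
        simpa [sub_eq_zero, add_eq_zero_iff_eq_neg] using hx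
      · rintro (⟨-, rfl⟩ | ⟨-, rfl⟩ | ⟨-, rfl⟩) <;> ring
  rw [← SetLike.coe_sort_coe, Nat.card_coe_set_eq, h_ker, Set.ncard_insert_of_notMem,
    Set.ncard_insert_of_notMem, Set.ncard_pair]
  · simpa using hcc
  · simp [hc, hc.symm]
  · simp [eq_comm (a := (0 : (congruentCurve c).toAffine.Point))]

/-- Full rational `2`-torsion forces the number of points to be a multiple of `4`. -/
lemma four_dvd_card (hc : c ≠ 0) (h2 : (2 : F) ≠ 0) :
    4 ∣ Nat.card (congruentCurve c).toAffine.Point := by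
  classical
  rw [← card_ker_two hc h2]
  exact AddSubgroup.card_addSubgroup_dvd_card _

end congruentCurve


/-- For an odd prime `q` and `d` not divisible by `q`, with `a = q + 1 − #E(F_q)` for
`E : y² = x³ − d²x` over `F_q`, we have `16 ∣ (q − 1)(q + 1 − a)(q + 1 + a)`. -/
theorem sixteen_dvd_V (q : ℕ) (hq : q.Prime) (hqodd : Odd q)
    (d : ℤ) (hqd : ¬ ((q : ℤ) ∣ d))
    (a : ℤ)
    (ha : a = (q : ℤ) + 1 -
      (Nat.card (({ a₁ := 0, a₂ := 0, a₃ := 0, a₄ := -(d : ZMod q) ^ 2, a₆ := 0 } :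
        WeierstrassCurve (ZMod q)).toAffine.Point) : ℤ)) :
    (16 : ℤ) ∣ ((q : ℤ) - 1) * ((q : ℤ) + 1 - a) * ((q : ℤ) + 1 + a) := by
  have : Fact q.Prime := ⟨hq⟩
  have hc : (d : ZMod q) ≠ 0 := fun h ↦ hqd ((ZMod.intCast_zmod_eq_zero_iff_dvd d q).mp h)
  have h2 : (2 : ZMod q) ≠ 0 := Ring.two_ne_zero (by
    rw [ZMod.ringChar_zmod_n]
    rintro rfl
    exact absurd hqodd (by decide))
  obtain ⟨n, hn⟩ := congruentCurve.four_dvd_card hc h2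
  obtain ⟨k, hk⟩ := hqodd
  rw [hn] at ha
  subst ha
  refine ⟨2 * k * n * (k + 1 - n), ?_⟩
  rw [hk]
  push_cast
  ring
end
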